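/- Let a >= 1 and k >= 2 be integers satisfying 2(a-3) <= 3k, k <= 2a+2, and k + 2a congruent to 2 modulo 4. Then the starlike tree T(a, a+1, a+2, ..., a+k) with arms of lengths a, a+1, ..., a+k is not transmission irregular; that is, it has two distinct vertices with equal transmissions. -/

import Mathlib

/-- The transmission of a vertex `v`: the sum of distances from `v` to all vertices. -/
noncomputable def transmission {V : Type*} [Fintype V] (G : SimpleGraph V) (v : V) : ℕ :=
  ∑ u, G.dist v u

/-- A graph is transmission irregular if all vertices have pairwise distinct transmissions. -/
def TransmissionIrregular {V : Type*} [Fintype V] (G : SimpleGraph V) : Prop :=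
  Function.Injective (transmission G)

/-- The starlike tree `T(k 0, …, k (t-1))`: a central vertex (`none`) with `t` pendant
paths attached, the `i`-th of length `k i`; `some ⟨i, j⟩` is the vertex at distance
`j + 1` from the center on the `i`-th arm. -/
def starlike (t : ℕ) (k : Fin t → ℕ) :
    SimpleGraph (Option (Σ i : Fin t, Fin (k i))) :=
  SimpleGraph.fromRel (fun x y =>
    (∃ i : Fin t, ∃ j : Fin (k i), x = none ∧ y = some ⟨i, j⟩ ∧ (j : ℕ) = 0) ∨
    (∃ i : Fin t, ∃ j j' : Fin (k i), x = some ⟨i, j⟩ ∧ y = some ⟨i, j'⟩ ∧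
      (j' : ℕ) = (j : ℕ) + 1))

/-- A function vanishing at `x` that grows by at most one along edges, and that can be decreased
by one along an edge at each other vertex, is the distance from `x`. -/
theorem SimpleGraph.dist_eq_of_descent {V : Type*} {G : SimpleGraph V} {x : V} (f : V → ℕ)
    (hx : f x = 0) (hlip : ∀ y z, G.Adj y z → f z ≤ f y + 1)
    (hdesc : ∀ y, y ≠ x → ∃ z, G.Adj z y ∧ f y = f z + 1) (y : V) : G.dist x y = f y := by
  have lower : ∀ {u v : V} (w : G.Walk u v), f v ≤ f u + w.length := by
    intro u v w
    induction w with
    | nil => simp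
    | cons h w ih =>
      have := hlip _ _ h
      rw [SimpleGraph.Walk.length_cons]
      omega
  have upper : ∀ n y, f y = n → ∃ w : G.Walk x y, w.length = n := by
    intro n
    induction n with
    | zero =>
      intro y hy
      by_cases hyx : y = x
      · subst hyx
        exact ⟨.nil, rfl⟩
      · obtain ⟨z, -, hz⟩ := hdesc y hyx
        omega
    | succ n ih =>
      intro y hy
      have hyx : y ≠ x := by
        rintro rfl
        omega
      obtain ⟨z, hzy, hz⟩ := hdesc y hyx
      obtain ⟨w, hw⟩ := ih z (by omega)
      exact ⟨w.concat hzy, by rw [SimpleGraph.Walk.length_concat, hw]⟩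
  obtain ⟨w, hw⟩ := upper _ y rfl
  refine le_antisymm (hw ▸ SimpleGraph.dist_le w) ?_
  obtain ⟨w', hw'⟩ := w.reachable.exists_walk_length_eq_dist
  have := lower w'
  omega

section Starlike

variable {t : ℕ} {k : Fin t → ℕ}

theorem starlike_adj_none_some {i : Fin t} {j : Fin (k i)} :
    (starlike t k).Adj none (some ⟨i, j⟩) ↔ (j : ℕ) = 0 := by
  simp only [starlike, SimpleGraph.fromRel_adj]
  constructor
  · rintro ⟨-, (⟨i', j', -, h, h0⟩ | ⟨i', j', j'', h, -⟩) | (⟨i', j', h, -⟩ | ⟨i', j', j'', -, h, -⟩)⟩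
    · cases h
      exact h0
    all_goals cases h
  · exact fun h => ⟨nofun, .inl (.inl ⟨i, j, trivial, rfl, h⟩)⟩

theorem starlike_adj_some_some {i i' : Fin t} {j : Fin (k i)} {j' : Fin (k i')} :
    (starlike t k).Adj (some ⟨i, j⟩) (some ⟨i', j'⟩) ↔
      i = i' ∧ ((j' : ℕ) = j + 1 ∨ (j : ℕ) = j' + 1) := by
  simp only [starlike, SimpleGraph.fromRel_adj]
  constructor
  · rintro ⟨-, (⟨_, _, h, -⟩ | ⟨_, _, _, h, h', h0⟩) | (⟨_, _, h, -⟩ | ⟨_, _, _, h, h', h0⟩)⟩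
    · cases h
    · cases h
      cases h'
      exact ⟨rfl, .inl h0⟩
    · cases h
    · cases h
      cases h'
      exact ⟨rfl, .inr h0⟩
  · rintro ⟨rfl, h⟩
    refine ⟨?_, h.imp (fun h => .inr ⟨i, j, j', rfl, rfl, h⟩)
      (fun h => .inr ⟨i, j', j, rfl, rfl, h⟩)⟩
    intro e
    cases e
    omega

/-- The distance in a starlike tree from the vertex at distance `j + 1` from the center on the
`i`-th arm. -/
def starlikeDist (i : Fin t) (j : ℕ) : Option (Σ i : Fin t, Fin (k i)) → ℕ
  | none => j + 1
  | some ⟨i', j'⟩ => if i' = i then (j - j') + (j' - j) else j + j' + 2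

theorem starlike_dist_some (i : Fin t) (j : Fin (k i)) (y : Option (Σ i : Fin t, Fin (k i))) :
    (starlike t k).dist (some ⟨i, j⟩) y = starlikeDist i j y := by
  refine SimpleGraph.dist_eq_of_descent _ (by simp [starlikeDist]) ?_ ?_ y
  · rintro (_ | ⟨i₁, j₁⟩) (_ | ⟨i₂, j₂⟩) h
    · exact (h.ne rfl).elim
    · have := starlike_adj_none_some.1 h
      simp only [starlikeDist]
      split_ifs <;> omega
    · have := starlike_adj_none_some.1 h.symm
      simp only [starlikeDist]
      split_ifs <;> omega
    · obtain ⟨rfl, h⟩ := starlike_adj_some_some.1 h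
      simp only [starlikeDist]
      split_ifs <;> omega
  · rintro (_ | ⟨i', j'⟩) hy
    · refine ⟨some ⟨i, ⟨0, j.pos⟩⟩, (starlike_adj_none_some.2 rfl).symm, ?_⟩
      simp [starlikeDist]
    · by_cases hi : i' = i
      · subst hi
        have hne : (j' : ℕ) ≠ j := fun h => hy (by rw [Fin.ext h])
        rcases lt_or_gt_of_ne hne with h | h
        · refine ⟨some ⟨i', ⟨j' + 1, by omega⟩⟩, starlike_adj_some_some.2 ⟨rfl, .inr rfl⟩, ?_⟩
          simp only [starlikeDist, if_true]
          omega
        · refine ⟨some ⟨i', ⟨j' - 1, by omega⟩⟩,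
            starlike_adj_some_some.2 ⟨rfl, .inl (Nat.sub_add_cancel (by omega)).symm⟩, ?_⟩
          simp only [starlikeDist, if_true]
          omega
      · by_cases h0 : (j' : ℕ) = 0
        · refine ⟨none, starlike_adj_none_some.2 h0, ?_⟩
          simp [starlikeDist, hi, h0]
        · refine ⟨some ⟨i', ⟨j' - 1, by omega⟩⟩,
            starlike_adj_some_some.2 ⟨rfl, .inl (Nat.sub_add_cancel (by omega)).symm⟩, ?_⟩
          simp only [starlikeDist, if_neg hi]
          omega

theorem two_mul_sum_min_add_one {j L : ℕ} (h : j < L) :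
    ∑ x ∈ Finset.range L, 2 * (min j x + 1) + (j + 1) * j = (j + 1) * (2 * L) := by
  induction L, h using Nat.le_induction with
  | base =>
    have : ∀ n ≤ j + 1, ∑ x ∈ Finset.range n, 2 * (min j x + 1) = n * (n + 1) := by
      intro n
      induction n with
      | zero => simp
      | succ n ih =>
        intro hn
        rw [Finset.sum_range_succ, ih (by omega), min_eq_right (by omega)]
        ring
    rw [this _ le_rfl, Nat.succ_eq_add_one]
    ring
  | succ L h ih =>
    rw [Finset.sum_range_succ, min_eq_left (by omega)]
    linarith

theorem starlike_transmission_some (i : Fin t) (j : Fin (k i)) :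
    transmission (starlike t k) (some ⟨i, j⟩) + (j + 1) * (2 * k i) =
      (j + 1) * (1 + ∑ i', k i') + (j + 1) * j + ∑ i', ∑ j' : Fin (k i'), ((j' : ℕ) + 1) := by
  have key : ∀ i' : Fin t, ∑ j' : Fin (k i'), starlikeDist i j (some ⟨i', j'⟩) +
      (if i' = i then ∑ j' : Fin (k i'), 2 * (min (j : ℕ) j' + 1) else 0) =
      (j + 1) * k i' + ∑ j' : Fin (k i'), ((j' : ℕ) + 1) := by
    intro i'
    have hc : (j + 1) * k i' = ∑ _j' : Fin (k i'), ((j : ℕ) + 1) := by simp [mul_comm]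
    rw [hc, ← Finset.sum_add_distrib]
    split_ifs with hi
    · rw [← Finset.sum_add_distrib]
      refine Finset.sum_congr rfl fun j' _ => ?_
      simp only [starlikeDist, if_pos hi]
      omega
    · rw [add_zero]
      refine Finset.sum_congr rfl fun j' _ => ?_
      simp only [starlikeDist, if_neg hi]
      omega
  have hsum := Finset.sum_congr (rfl : (Finset.univ : Finset (Fin t)) = _) fun i' _ => key i'
  rw [Finset.sum_add_distrib, Finset.sum_add_distrib, Finset.sum_ite_eq',
    if_pos (Finset.mem_univ i), ← Finset.mul_sum Finset.univ k, Fin.sum_univ_eq_sum_range (fun x => 2 * (min (j : ℕ) x + 1))] at hsum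
  have hmin := two_mul_sum_min_add_one j.isLt
  simp only [transmission, starlike_dist_some, Fintype.sum_option, Fintype.sum_sigma]
  have hnone : starlikeDist (k := k) i j none = j + 1 := rfl
  rw [hnone]
  linarith

end Starlike

/-- If `2(a-3) ≤ 3k`, `k ≤ 2a + 2` and `k + 2a ≡ 2 (mod 4)`, then
`T(a, a+1, …, a+k)` is not transmission irregular. -/
theorem stmt_10 (a k : ℕ) (ha : 1 ≤ a) (hk : 2 ≤ k)
    (h1 : 2 * ((a : ℤ) - 3) ≤ 3 * (k : ℤ)) (h2 : (k : ℤ) ≤ 2 * (a : ℤ) + 2)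
    (hcong : (k + 2 * a) % 4 = 2) :
    ¬ TransmissionIrregular (starlike (k + 1) (fun i => a + i.val)) := by
  intro hinj
  obtain ⟨h, rfl⟩ : ∃ h, k = 2 * h := ⟨k / 2, by omega⟩
  obtain ⟨q, hq⟩ : ∃ q, a + h = 2 * q + 3 := ⟨(a + h - 3) / 2, by omega⟩
  have hsum : ∑ i : Fin (2 * h + 1), (a + (i : ℕ)) = (2 * h + 1) * (a + h) := by
    rw [Fin.sum_univ_eq_sum_range (fun x => a + x), Finset.sum_add_distrib, Finset.sum_const,
      Finset.card_range, smul_eq_mul]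
    have := Finset.sum_range_id_mul_two (2 * h + 1)
    rw [Nat.add_sub_cancel] at this
    linarith
  have e₁ := starlike_transmission_some (k := fun i : Fin (2 * h + 1) => a + i.val)
    0 ⟨q, by simp only [Fin.val_zero]; omega⟩
  have e₂ := starlike_transmission_some (k := fun i : Fin (2 * h + 1) => a + i.val)
    (Fin.last (2 * h)) ⟨q + 1, by simp only [Fin.val_last]; omega⟩
  simp only [hsum, Fin.val_zero, Fin.val_last] at e₁ e₂
  have arith : ∀ {T₁ T₂ S : ℕ},
      T₁ + (q + 1) * (2 * (a + 0)) =
        (q + 1) * (1 + (2 * h + 1) * (2 * q + 3)) + (q + 1) * q + S →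
      T₂ + (q + 1 + 1) * (2 * (a + 2 * h)) =
        (q + 1 + 1) * (1 + (2 * h + 1) * (2 * q + 3)) + (q + 1 + 1) * (q + 1) + S →
      T₁ = T₂ := by
    intro T₁ T₂ S h₁ h₂
    have hqa : q * a + q * h = q * (2 * q + 3) := by rw [← hq, mul_add]
    linarith
  have heq := hinj (a₁ := some ⟨0, ⟨q, by simp only [Fin.val_zero]; omega⟩⟩)
    (a₂ := some ⟨Fin.last (2 * h), ⟨q + 1, by simp only [Fin.val_last]; omega⟩⟩) (by
      rw [hq] at e₁ e₂
      exact arith e₁ e₂)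
  have := congrArg Sigma.fst (Option.some.inj heq)
  simp only [Fin.ext_iff, Fin.val_zero, Fin.val_last] at this
  omega
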